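/- arXiv:1003.1348 — 7 statements merged into one kernel-verified Lean document; each statement's English description precedes it below -/
import Mathlib

section
/- The set K₁ of linear maps M : V₀ → V₁ such that 1+d∘M : V₀ → V₀ and 1+M∘d : V₁ → V₁ are bijective is a group under the multiplication M·N := M+N+M∘d∘N, with identity element 0 and with the inverse of M given by M⁻¹ = −(1+M∘d)⁻¹∘M; in particular K₁ is closed under this multiplication and under taking this inverse, and the multiplication is associative. -/
/- Context: k a field, V₀, V₁ vector spaces over k, d : V₁ → V₀ linear.
   STATEMENT 5: the set K₁ of linear maps M : V₀ → V₁ such that 1+d∘M and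
   1+M∘d are bijective is a group under M·N := M+N+M∘d∘N, with identity 0 and
   inverse M⁻¹ = −(1+M∘d)⁻¹∘M; in particular K₁ is closed under multiplication
   and this inverse, and the multiplication is associative. -/

variable {k V0 V1 : Type*} [Field k] [AddCommGroup V0] [Module k V0]
  [AddCommGroup V1] [Module k V1]

/-- Membership in K₁: both 1+d∘M and 1+M∘d are bijective. -/
def K1mem (d : V1 →ₗ[k] V0) (M : V0 →ₗ[k] V1) : Prop :=
  Function.Bijective ((1 : Module.End k V0) + d ∘ₗ M) ∧
  Function.Bijective ((1 : Module.End k V1) + M ∘ₗ d)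

/-- The multiplication on K₁: M·N := M+N+M∘d∘N. -/
def K1mul (d : V1 →ₗ[k] V0) (M N : V0 →ₗ[k] V1) : V0 →ₗ[k] V1 :=
  M + N + M ∘ₗ d ∘ₗ N

/-- The inverse in K₁: M⁻¹ = −(1+M∘d)⁻¹∘M. -/
noncomputable def K1inv (d : V1 →ₗ[k] V0) (M : V0 →ₗ[k] V1)
    (h : Function.Bijective ((1 : Module.End k V1) + M ∘ₗ d)) : V0 →ₗ[k] V1 :=
  -((LinearEquiv.ofBijective ((1 : Module.End k V1) + M ∘ₗ d) h).symm.toLinearMap ∘ₗ M)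

theorem K1_hom0 (d : V1 →ₗ[k] V0) (M N : V0 →ₗ[k] V1) :
    (1 : Module.End k V0) + d ∘ₗ K1mul d M N =
      ((1 : Module.End k V0) + d ∘ₗ M) ∘ₗ ((1 : Module.End k V0) + d ∘ₗ N) := by
  ext x
  simp [K1mul]
  abel

theorem K1_hom1 (d : V1 →ₗ[k] V0) (M N : V0 →ₗ[k] V1) :
    (1 : Module.End k V1) + K1mul d M N ∘ₗ d =
      ((1 : Module.End k V1) + M ∘ₗ d) ∘ₗ ((1 : Module.End k V1) + N ∘ₗ d) := by
  ext x
  simp [K1mul]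
  abel

theorem K1_bij {W : Type*} [AddCommGroup W] [Module k W] (f g : W →ₗ[k] W)
    (h1 : f ∘ₗ g = LinearMap.id) (h2 : g ∘ₗ f = LinearMap.id) : Function.Bijective g :=
  Function.bijective_iff_has_inverse.2
    ⟨f, fun x => LinearMap.congr_fun h1 x, fun x => LinearMap.congr_fun h2 x⟩

theorem K1_mul_inv (d : V1 →ₗ[k] V0) (M : V0 →ₗ[k] V1)
    (h : Function.Bijective ((1 : Module.End k V1) + M ∘ₗ d)) (x : V0) :
    K1inv d M h x + M (d (K1inv d M h x)) = - M x := by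
  have := (LinearEquiv.ofBijective ((1 : Module.End k V1) + M ∘ₗ d) h).apply_symm_apply (-M x)
  simpa [K1inv] using this

theorem stmt_5 (d : V1 →ₗ[k] V0) :
    -- closure under multiplication
    (∀ M N : V0 →ₗ[k] V1, K1mem d M → K1mem d N → K1mem d (K1mul d M N)) ∧
    -- associativity
    (∀ M N P : V0 →ₗ[k] V1, K1mul d (K1mul d M N) P = K1mul d M (K1mul d N P)) ∧
    -- 0 is the identity element, and lies in K₁
    K1mem d (0 : V0 →ₗ[k] V1) ∧
    (∀ M : V0 →ₗ[k] V1, K1mul d 0 M = M ∧ K1mul d M 0 = M) ∧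
    -- inverses: K₁ is closed under the inverse, which is a two-sided inverse
    (∀ (M : V0 →ₗ[k] V1) (h : K1mem d M),
      K1mem d (K1inv d M h.2) ∧
      K1mul d M (K1inv d M h.2) = 0 ∧ K1mul d (K1inv d M h.2) M = 0) := by
  refine ⟨?_, ?_, ?_, ?_, ?_⟩
  · rintro M N ⟨a, b⟩ ⟨a', b'⟩
    refine ⟨?_, ?_⟩
    · rw [K1_hom0, LinearMap.coe_comp]
      exact a.comp a'
    · rw [K1_hom1, LinearMap.coe_comp]
      exact b.comp b'
  · intro M N P
    ext x
    simp [K1mul]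
    abel
  · refine ⟨?_, ?_⟩
    · simp only [LinearMap.comp_zero, LinearMap.zero_comp, add_zero]
      exact Function.bijective_id
    · simp only [LinearMap.comp_zero, LinearMap.zero_comp, add_zero]
      exact Function.bijective_id
  · intro M
    constructor <;> simp [K1mul]
  · intro M h
    have r : K1mul d M (K1inv d M h.2) = 0 := by
      ext x
      have := K1_mul_inv d M h.2 x
      simp only [K1mul, LinearMap.add_apply, LinearMap.comp_apply, LinearMap.zero_apply]
      rw [add_assoc, this, add_neg_cancel]
    have l : K1mul d (K1inv d M h.2) M = 0 := by
      ext x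
      apply h.2.1
      have e1 := K1_mul_inv d M h.2 x
      have e2 := K1_mul_inv d M h.2 (d (M x))
      simp only [K1mul, LinearMap.add_apply, LinearMap.comp_apply, LinearMap.zero_apply,
        Module.End.one_apply, map_add, map_zero]
      generalize K1inv d M h.2 x = u at *
      generalize K1inv d M h.2 (d (M x)) = v at *
      generalize M (d u) = u' at *
      generalize M (d v) = v' at *
      rw [← eq_sub_iff_add_eq] at e1 e2
      rw [e1, e2]
      abel
    refine ⟨⟨?_, ?_⟩, r, l⟩
    · apply K1_bij ((1 : Module.End k V0) + d ∘ₗ M)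
      · rw [← K1_hom0, r]; ext x; simp
      · rw [← K1_hom0, l]; ext x; simp
    · apply K1_bij ((1 : Module.End k V1) + M ∘ₗ d)
      · rw [← K1_hom1, r]; ext x; simp
      · rw [← K1_hom1, l]; ext x; simp
end

section
/- Let (Ψ₁,Ψ₀) be a strict morphism of crossed modules from (H₁,H₀,t,Φ) to Aut(𝕍). Then: (i) the multiplication (a,m)(b,n) := (ab, m + Ψ₀¹(t(a))(n)) makes H₁ × V₁ a group H₁⋉V₁ with identity (1,0); (ii) the multiplication (x,ξ)(y,η) := (xy, ξ + Ψ₀⁰(x)(η)) makes H₀ × V₀ a group H₀⋉V₀; (iii) the formula Φ̃_{(x,ξ)}(a,m) := (Φ_x(a), Ψ₀¹(x)(m) − Ψ₀¹(x)∘Ψ₁(a)∘Ψ₀⁰(x⁻¹)(ξ)) defines an action of the group H₀⋉V₀ on the group H₁⋉V₁ by group automorphisms, i.e. each Φ̃_{(x,ξ)} is a group automorphism of H₁⋉V₁ and Φ̃_{(x,ξ)(y,η)} = Φ̃_{(x,ξ)}∘Φ̃_{(y,η)}. -/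
/- Context: k a field, V₀, V₁ vector spaces over k, d : V₁ → V₀ linear.
   K₁ = {M : V₀ → V₁ | 1+d∘M, 1+M∘d bijective} with M·N := M+N+M∘d∘N;
   K₀ = {(B₀,B₁) ∈ GL(V₀)×GL(V₁) | B₀∘d = d∘B₁}.
   A strict morphism (Ψ₁,Ψ₀) from a crossed module of groups (H₁,H₀,t,Φ) to
   Aut(𝕍) = (K₁,K₀,∫δ,Φ): Ψ₁ : H₁ → K₁ a group homomorphism,
   Ψ₀ = (Ψ₀⁰,Ψ₀¹) : H₀ → K₀ a group homomorphism, with Ψ₀⁰(t(a)) = 1+d∘Ψ₁(a),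
   Ψ₀¹(t(a)) = 1+Ψ₁(a)∘d, Ψ₁(Φ_x(a)) = Ψ₀¹(x)∘Ψ₁(a)∘Ψ₀⁰(x)⁻¹.
   STATEMENT 11: (i) (a,m)(b,n) := (ab, m + Ψ₀¹(t(a))(n)) makes H₁ × V₁ a group
   H₁⋉V₁ with identity (1,0); (ii) (x,ξ)(y,η) := (xy, ξ + Ψ₀⁰(x)(η)) makes
   H₀ × V₀ a group H₀⋉V₀; (iii) Φ̃_{(x,ξ)}(a,m) :=
   (Φ_x(a), Ψ₀¹(x)(m) − Ψ₀¹(x)∘Ψ₁(a)∘Ψ₀⁰(x⁻¹)(ξ)) defines an action of H₀⋉V₀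
   on H₁⋉V₁ by group automorphisms. -/

/-- A strict morphism of crossed modules of groups from `(H₁,H₀,t,Φ)` to
`Aut(𝕍) = (K₁,K₀,∫δ,Φ)`.  `Ψ00`, `Ψ01` are the two components of `Ψ₀`,
multiplicative maps into the monoids `End(V₀)`, `End(V₁)` whose values are
bijective (i.e. land in `GL(V₀)`, `GL(V₁)`).  `Ψ₀⁰(x)⁻¹` is expressed as
`Ψ₀⁰(x⁻¹)`. -/
structure StrictToAut (k : Type*) [Field k] (V0 V1 : Type*)
    [AddCommGroup V0] [Module k V0] [AddCommGroup V1] [Module k V1]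
    (H1 H0 : Type*) [Group H1] [Group H0]
    (d : V1 →ₗ[k] V0) (t : H1 →* H0) (Φ : H0 →* MulAut H1) where
  /-- the crossed module equivariance t(Φ_x(a)) = x·t(a)·x⁻¹ -/
  cm_equivar : ∀ (x : H0) (a : H1), t (Φ x a) = x * t a * x⁻¹
  /-- the Pfeiffer identity Φ_{t(a)}(b) = a·b·a⁻¹ -/
  cm_peiffer : ∀ a b : H1, Φ (t a) b = a * b * a⁻¹
  Ψ1 : H1 → (V0 →ₗ[k] V1)
  Ψ00 : H0 →* Module.End k V0
  Ψ01 : H0 →* Module.End k V1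
  /-- Ψ₁ is a group homomorphism into (K₁, ·) -/
  Ψ1_mul : ∀ a b : H1, Ψ1 (a * b) = Ψ1 a + Ψ1 b + Ψ1 a ∘ₗ d ∘ₗ Ψ1 b
  Ψ1_mem : ∀ a : H1, Function.Bijective ((1 : Module.End k V0) + d ∘ₗ Ψ1 a) ∧
    Function.Bijective ((1 : Module.End k V1) + Ψ1 a ∘ₗ d)
  /-- Ψ₀ lands in GL(V₀) × GL(V₁) -/
  Ψ00_bij : ∀ x : H0, Function.Bijective (Ψ00 x)
  Ψ01_bij : ∀ x : H0, Function.Bijective (Ψ01 x)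
  /-- Ψ₀ lands in K₀ -/
  comm : ∀ x : H0, Ψ00 x ∘ₗ d = d ∘ₗ Ψ01 x
  compat0 : ∀ a : H1, Ψ00 (t a) = 1 + d ∘ₗ Ψ1 a
  compat1 : ∀ a : H1, Ψ01 (t a) = 1 + Ψ1 a ∘ₗ d
  equivar : ∀ (x : H0) (a : H1), Ψ1 (Φ x a) = Ψ01 x ∘ₗ Ψ1 a ∘ₗ Ψ00 x⁻¹

variable {k V0 V1 : Type*} [Field k] [AddCommGroup V0] [Module k V0]
  [AddCommGroup V1] [Module k V1] {H1 H0 : Type*} [Group H1] [Group H0]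


variable {d : V1 →ₗ[k] V0} {t : H1 →* H0} {Φ : H0 →* MulAut H1}

/-- The multiplication of the semidirect product H₁⋉V₁. -/
def mul1 (Ψ : StrictToAut k V0 V1 H1 H0 d t Φ) (p q : H1 × V1) : H1 × V1 :=
  (p.1 * q.1, p.2 + Ψ.Ψ01 (t p.1) q.2)

/-- The multiplication of the semidirect product H₀⋉V₀. -/
def mul0 (Ψ : StrictToAut k V0 V1 H1 H0 d t Φ) (p q : H0 × V0) : H0 × V0 :=
  (p.1 * q.1, p.2 + Ψ.Ψ00 p.1 q.2)

/-- The action Φ̃ of H₀⋉V₀ on H₁⋉V₁. -/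
def tPhi (Ψ : StrictToAut k V0 V1 H1 H0 d t Φ) (x : H0 × V0) (a : H1 × V1) :
    H1 × V1 :=
  (Φ x.1 a.1, Ψ.Ψ01 x.1 a.2 - (Ψ.Ψ01 x.1 ∘ₗ Ψ.Ψ1 a.1 ∘ₗ Ψ.Ψ00 x.1⁻¹) x.2)

theorem stmt_11 (d : V1 →ₗ[k] V0) (t : H1 →* H0) (Φ : H0 →* MulAut H1)
    (Ψ : StrictToAut k V0 V1 H1 H0 d t Φ) :
    -- (i) H₁⋉V₁ is a group with identity (1,0)
    (∀ p q r : H1 × V1, mul1 Ψ (mul1 Ψ p q) r = mul1 Ψ p (mul1 Ψ q r)) ∧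
    (∀ p : H1 × V1, mul1 Ψ (1, 0) p = p ∧ mul1 Ψ p (1, 0) = p) ∧
    (∀ p : H1 × V1, ∃ q : H1 × V1, mul1 Ψ p q = (1, 0) ∧ mul1 Ψ q p = (1, 0)) ∧
    -- (ii) H₀⋉V₀ is a group with identity (1,0)
    (∀ p q r : H0 × V0, mul0 Ψ (mul0 Ψ p q) r = mul0 Ψ p (mul0 Ψ q r)) ∧
    (∀ p : H0 × V0, mul0 Ψ (1, 0) p = p ∧ mul0 Ψ p (1, 0) = p) ∧
    (∀ p : H0 × V0, ∃ q : H0 × V0, mul0 Ψ p q = (1, 0) ∧ mul0 Ψ q p = (1, 0)) ∧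
    -- (iii) Φ̃ is an action by group automorphisms
    (∀ x : H0 × V0, Function.Bijective (tPhi Ψ x)) ∧
    (∀ (x : H0 × V0) (p q : H1 × V1),
      tPhi Ψ x (mul1 Ψ p q) = mul1 Ψ (tPhi Ψ x p) (tPhi Ψ x q)) ∧
    (∀ p : H1 × V1, tPhi Ψ (1, 0) p = p) ∧
    (∀ (x y : H0 × V0) (p : H1 × V1),
      tPhi Ψ (mul0 Ψ x y) p = tPhi Ψ x (tPhi Ψ y p)) := by
  have c0 : ∀ (x : H0) (v : V0), Ψ.Ψ00 x⁻¹ (Ψ.Ψ00 x v) = v := fun x v => by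
    rw [← Module.End.mul_apply, ← map_mul]; simp
  have c0' : ∀ (x : H0) (v : V0), Ψ.Ψ00 x (Ψ.Ψ00 x⁻¹ v) = v := fun x v => by
    rw [← Module.End.mul_apply, ← map_mul]; simp
  have c1 : ∀ (x : H0) (v : V1), Ψ.Ψ01 x⁻¹ (Ψ.Ψ01 x v) = v := fun x v => by
    rw [← Module.End.mul_apply, ← map_mul]; simp
  have c1' : ∀ (x : H0) (v : V1), Ψ.Ψ01 x (Ψ.Ψ01 x⁻¹ v) = v := fun x v => by
    rw [← Module.End.mul_apply, ← map_mul]; simp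
  have inv0 : ∀ p : H0 × V0, ∃ q : H0 × V0,
      mul0 Ψ p q = (1, 0) ∧ mul0 Ψ q p = (1, 0) := by
    rintro ⟨x, v⟩
    refine ⟨(x⁻¹, - Ψ.Ψ00 x⁻¹ v), ?_, ?_⟩ <;> simp [mul0, c0']
  have one : ∀ p : H1 × V1, tPhi Ψ (1, 0) p = p := by
    rintro ⟨a, m⟩
    simp [tPhi]
  have act : ∀ (x y : H0 × V0) (p : H1 × V1),
      tPhi Ψ (mul0 Ψ x y) p = tPhi Ψ x (tPhi Ψ y p) := by
    rintro ⟨x, v⟩ ⟨y, w⟩ ⟨a, m⟩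
    simp only [tPhi, mul0, Ψ.equivar, map_mul, mul_inv_rev, MulAut.mul_apply,
      Module.End.mul_apply, LinearMap.comp_apply, map_add, map_sub, c0]
    congr 1
    abel
  refine ⟨?_, ?_, ?_, ?_, ?_, inv0, ?_, ?_, one, act⟩
  · rintro ⟨a, m⟩ ⟨b, n⟩ ⟨c, l⟩
    simp [mul1, mul_assoc, add_assoc]
  · rintro ⟨a, m⟩
    simp [mul1]
  · rintro ⟨a, m⟩
    refine ⟨(a⁻¹, - Ψ.Ψ01 (t a)⁻¹ m), ?_, ?_⟩ <;> simp [mul1, c1']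
  · rintro ⟨a, m⟩ ⟨b, n⟩ ⟨c, l⟩
    simp [mul0, mul_assoc, add_assoc]
  · rintro ⟨a, m⟩
    simp [mul0]
  · intro x
    obtain ⟨y, h1, h2⟩ := inv0 x
    refine Function.bijective_iff_has_inverse.mpr ⟨tPhi Ψ y, fun p => ?_, fun p => ?_⟩
    · rw [← act, h2, one]
    · rw [← act, h1, one]
  · rintro ⟨x, v⟩ ⟨a, m⟩ ⟨b, n⟩
    simp only [tPhi, mul1, Ψ.cm_equivar, Ψ.Ψ1_mul, Ψ.compat1, map_mul,
      Module.End.mul_apply, LinearMap.comp_apply, LinearMap.add_apply,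
      Module.End.one_apply, map_add, map_sub, c1]
    congr 1
    abel
end

section
/- Let (Ψ₁,Ψ₀) be a strict morphism of crossed modules from (H₁,H₀,t,Φ) to Aut(𝕍), and let H₁⋉V₁, H₀⋉V₀ and Φ̃ be as defined by (a,m)(b,n) := (ab, m + Ψ₀¹(t(a))(n)), (x,ξ)(y,η) := (xy, ξ + Ψ₀⁰(x)(η)), and Φ̃_{(x,ξ)}(a,m) := (Φ_x(a), Ψ₀¹(x)(m) − Ψ₀¹(x)∘Ψ₁(a)∘Ψ₀⁰(x⁻¹)(ξ)). Then the map t×d : H₁⋉V₁ → H₀⋉V₀, (a,m) ↦ (t(a), d(m)), is a group homomorphism which is (H₀⋉V₀)-equivariant, i.e. (t×d)(Φ̃_{(x,ξ)}(a,m)) = (x,ξ)·(t(a),d(m))·(x,ξ)⁻¹, and the Pfeiffer identity Φ̃_{(t(a),d(m))}(b,n) = (a,m)(b,n)(a,m)⁻¹ holds; hence (H₁⋉V₁, H₀⋉V₀, t×d, Φ̃) is a crossed module of groups. -/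
variable {k V0 V1 : Type*} [Field k] [AddCommGroup V0] [Module k V0]
  [AddCommGroup V1] [Module k V1] {H1 H0 : Type*} [Group H1] [Group H0]


variable {d : V1 →ₗ[k] V0} {t : H1 →* H0} {Φ : H0 →* MulAut H1}

/-- The inverse in the group H₁⋉V₁. -/
def inv1 (Ψ : StrictToAut k V0 V1 H1 H0 d t Φ) (p : H1 × V1) : H1 × V1 :=
  (p.1⁻¹, -Ψ.Ψ01 (t p.1⁻¹) p.2)

/-- The inverse in the group H₀⋉V₀. -/
def inv0 (Ψ : StrictToAut k V0 V1 H1 H0 d t Φ) (p : H0 × V0) : H0 × V0 :=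
  (p.1⁻¹, -Ψ.Ψ00 p.1⁻¹ p.2)

/-- The map t×d : H₁⋉V₁ → H₀⋉V₀. -/
def tTimesd (d : V1 →ₗ[k] V0) (t : H1 →* H0) (p : H1 × V1) : H0 × V0 :=
  (t p.1, d p.2)

theorem stmt_12 (d : V1 →ₗ[k] V0) (t : H1 →* H0) (Φ : H0 →* MulAut H1)
    (Ψ : StrictToAut k V0 V1 H1 H0 d t Φ) :
    -- inv1 and inv0 are indeed the inverses in H₁⋉V₁ and H₀⋉V₀
    (∀ p : H1 × V1, mul1 Ψ p (inv1 Ψ p) = (1, 0) ∧ mul1 Ψ (inv1 Ψ p) p = (1, 0)) ∧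
    (∀ x : H0 × V0, mul0 Ψ x (inv0 Ψ x) = (1, 0) ∧ mul0 Ψ (inv0 Ψ x) x = (1, 0)) ∧
    -- t×d is a group homomorphism
    (tTimesd d t ((1 : H1), (0 : V1)) = ((1 : H0), (0 : V0))) ∧
    (∀ p q : H1 × V1,
      tTimesd d t (mul1 Ψ p q) = mul0 Ψ (tTimesd d t p) (tTimesd d t q)) ∧
    -- equivariance: (t×d)(Φ̃_{(x,ξ)}(a,m)) = (x,ξ)·(t(a),d(m))·(x,ξ)⁻¹
    (∀ (x : H0 × V0) (p : H1 × V1),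
      tTimesd d t (tPhi Ψ x p) = mul0 Ψ (mul0 Ψ x (tTimesd d t p)) (inv0 Ψ x)) ∧
    -- the Pfeiffer identity: Φ̃_{(t(a),d(m))}(b,n) = (a,m)(b,n)(a,m)⁻¹
    (∀ p q : H1 × V1,
      tPhi Ψ (tTimesd d t p) q = mul1 Ψ (mul1 Ψ p q) (inv1 Ψ p)) := by
  have h0 : ∀ (x y : H0) (v : V0), Ψ.Ψ00 (x * y) v = Ψ.Ψ00 x (Ψ.Ψ00 y v) := fun x y v => by
    rw [map_mul]; rfl
  have h1 : ∀ (x y : H0) (v : V1), Ψ.Ψ01 (x * y) v = Ψ.Ψ01 x (Ψ.Ψ01 y v) := fun x y v => by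
    rw [map_mul]; rfl
  have i0 : ∀ (x : H0) (v : V0), Ψ.Ψ00 x (Ψ.Ψ00 x⁻¹ v) = v := fun x v => by
    rw [← h0]; simp
  have i1 : ∀ (x : H0) (v : V1), Ψ.Ψ01 x (Ψ.Ψ01 x⁻¹ v) = v := fun x v => by
    rw [← h1]; simp
  have c : ∀ (x : H0) (v : V1), Ψ.Ψ00 x (d v) = d (Ψ.Ψ01 x v) := fun x v =>
    LinearMap.congr_fun (Ψ.comm x) v
  have k0 : ∀ (a : H1) (v : V0), Ψ.Ψ00 (t a) v = v + d (Ψ.Ψ1 a v) := fun a v => by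
    rw [Ψ.compat0]; rfl
  have k1 : ∀ (a : H1) (v : V1), Ψ.Ψ01 (t a) v = v + Ψ.Ψ1 a (d v) := fun a v => by
    rw [Ψ.compat1]; rfl
  refine ⟨?_, ?_, ?_, ?_, ?_, ?_⟩
  · rintro ⟨a, m⟩
    refine ⟨Prod.ext (by simp [mul1, inv1]) ?_, Prod.ext (by simp [mul1, inv1]) ?_⟩
    · simp only [mul1, inv1, map_neg, map_inv, i1, add_neg_cancel]
    · simp only [mul1, inv1, neg_add_cancel]
  · rintro ⟨a, m⟩
    refine ⟨Prod.ext (by simp [mul0, inv0]) ?_, Prod.ext (by simp [mul0, inv0]) ?_⟩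
    · simp only [mul0, inv0, map_neg, i0, add_neg_cancel]
    · simp only [mul0, inv0, neg_add_cancel]
  · simp [tTimesd]
  · rintro ⟨a, m⟩ ⟨b, n⟩
    simp [tTimesd, mul0, mul1, c]
  · rintro ⟨x, ξ⟩ ⟨a, m⟩
    refine Prod.ext (by simp [tTimesd, tPhi, mul0, inv0, Ψ.cm_equivar]) ?_
    simp only [tTimesd, tPhi, mul0, inv0, LinearMap.comp_apply, map_sub, map_neg, h0, k0,
      map_add, i0, ← c]
    abel
  · rintro ⟨a, m⟩ ⟨b, n⟩
    refine Prod.ext (by simp [tTimesd, tPhi, mul1, inv1, Ψ.cm_peiffer]) ?_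
    have e : Ψ.Ψ01 (t (a * b)) (Ψ.Ψ01 (t a⁻¹) m)
        = m + Ψ.Ψ01 (t a) (Ψ.Ψ1 b (Ψ.Ψ00 (t a)⁻¹ (d m))) := by
      rw [map_mul, h1, k1 b, map_add, map_inv, i1, c]
    simp only [tTimesd, tPhi, mul1, inv1, LinearMap.comp_apply, map_neg]
    rw [e]
    abel
end

section
/- Let (ψ₁,ψ₀) be a strict morphism of crossed modules of Lie algebras from (𝔥₁,𝔥₀,dt,φ) to End(𝕍), and equip 𝔥₀ ⊕ V₀ with the bracket [(X,ξ),(Y,η)] := ([X,Y], ψ₀⁰(X)(η) − ψ₀⁰(Y)(ξ)) and 𝔥₁ ⊕ V₁ with the bracket [(A,m),(B,n)] := ([A,B], ψ₀¹(dt(A))(n) − ψ₀¹(dt(B))(m)). Define φ̃_{(X,ξ)}(A,m) := (φ_X(A), ψ₀¹(X)(m) − ψ₁(A)(ξ)). Then: (i) φ̃ is an action of 𝔥₀ ⊕ V₀ on 𝔥₁ ⊕ V₁ by derivations, i.e. each φ̃_{(X,ξ)} is a derivation of the bracket of 𝔥₁ ⊕ V₁ and φ̃_{[(X,ξ),(Y,η)]}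 = φ̃_{(X,ξ)}∘φ̃_{(Y,η)} − φ̃_{(Y,η)}∘φ̃_{(X,ξ)}; (ii) (dt×d)(φ̃_{(X,ξ)}(A,m)) = [(X,ξ), (dt(A),d(m))]; (iii) φ̃_{(dt(A),d(m))}(B,n) = [(A,m),(B,n)]. Hence (𝔥₁⋉V₁, 𝔥₀⋉V₀, dt×d, φ̃) is a crossed module of Lie algebras. -/
/- Context: k a field, V₀, V₁ vector spaces over k, d : V₁ → V₀ linear.
   𝔨₁ = Hom(V₀,V₁) with [A,B] = A∘d∘B − B∘d∘A; 𝔨₀ = {(X₀,X₁) | X₀∘d = d∘X₁}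
   with componentwise commutator; δ(A) = (d∘A, A∘d); End(𝕍) = (𝔨₁,𝔨₀,δ,φ) with
   φ_{(X₀,X₁)}(A) = X₁∘A − A∘X₀.  (ψ₁,ψ₀) is a strict morphism of crossed
   modules of Lie algebras from (𝔥₁,𝔥₀,dt,φ) to End(𝕍).
   𝔥₀ ⊕ V₀ carries the bracket [(X,ξ),(Y,η)] := ([X,Y], ψ₀⁰(X)(η) − ψ₀⁰(Y)(ξ)),
   𝔥₁ ⊕ V₁ the bracket [(A,m),(B,n)] := ([A,B], ψ₀¹(dt(A))(n) − ψ₀¹(dt(B))(m)).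
   STATEMENT 14: φ̃_{(X,ξ)}(A,m) := (φ_X(A), ψ₀¹(X)(m) − ψ₁(A)(ξ)) satisfies:
   (i) φ̃ is an action of 𝔥₀ ⊕ V₀ on 𝔥₁ ⊕ V₁ by derivations:
   each φ̃_{(X,ξ)} is a derivation of the bracket of 𝔥₁ ⊕ V₁ and
   φ̃_{[(X,ξ),(Y,η)]} = φ̃_{(X,ξ)}∘φ̃_{(Y,η)} − φ̃_{(Y,η)}∘φ̃_{(X,ξ)};
   (ii) (dt×d)(φ̃_{(X,ξ)}(A,m)) = [(X,ξ),(dt(A),d(m))];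
   (iii) φ̃_{(dt(A),d(m))}(B,n) = [(A,m),(B,n)].
   Hence (𝔥₁⋉V₁, 𝔥₀⋉V₀, dt×d, φ̃) is a crossed module of Lie algebras. -/

/-- A crossed module of Lie algebras `(𝔥₁,𝔥₀,dt,φ)` together with a strict
morphism `(ψ₁,ψ₀)` to the crossed module `End(𝕍) = (𝔨₁,𝔨₀,δ,φ)`, where
`ψ₀ = (ψ00, ψ01)` componentwise. -/
structure LieStrictToEnd (k : Type*) [Field k] (V0 V1 : Type*)
    [AddCommGroup V0] [Module k V0] [AddCommGroup V1] [Module k V1]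
    (h1 h0 : Type*) [LieRing h1] [LieAlgebra k h1] [LieRing h0] [LieAlgebra k h0]
    (d : V1 →ₗ[k] V0) (dt : h1 →ₗ[k] h0) (φ : h0 →ₗ[k] h1 →ₗ[k] h1) where
  /-- dt is a Lie algebra homomorphism -/
  dt_bracket : ∀ A B : h1, dt ⁅A, B⁆ = ⁅dt A, dt B⁆
  /-- φ acts by derivations -/
  φ_der : ∀ (X : h0) (A B : h1), φ X ⁅A, B⁆ = ⁅φ X A, B⁆ + ⁅A, φ X B⁆
  /-- φ is a Lie algebra homomorphism 𝔥₀ → Der(𝔥₁) -/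
  φ_hom : ∀ (X Y : h0) (A : h1), φ ⁅X, Y⁆ A = φ X (φ Y A) - φ Y (φ X A)
  /-- dt(φ_X(A)) = [X, dt(A)] -/
  cm1 : ∀ (X : h0) (A : h1), dt (φ X A) = ⁅X, dt A⁆
  /-- the Pfeiffer identity φ_{dt(A)}(B) = [A,B] -/
  cm2 : ∀ A B : h1, φ (dt A) B = ⁅A, B⁆
  ψ1 : h1 →ₗ[k] (V0 →ₗ[k] V1)
  ψ00 : h0 →ₗ[k] Module.End k V0
  ψ01 : h0 →ₗ[k] Module.End k V1
  /-- ψ₁ is a Lie algebra homomorphism into 𝔨₁ -/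
  ψ1_bracket : ∀ A B : h1,
    ψ1 ⁅A, B⁆ = ψ1 A ∘ₗ d ∘ₗ ψ1 B - ψ1 B ∘ₗ d ∘ₗ ψ1 A
  /-- ψ₀ is a Lie algebra homomorphism, componentwise -/
  ψ00_bracket : ∀ X Y : h0, ψ00 ⁅X, Y⁆ = ψ00 X * ψ00 Y - ψ00 Y * ψ00 X
  ψ01_bracket : ∀ X Y : h0, ψ01 ⁅X, Y⁆ = ψ01 X * ψ01 Y - ψ01 Y * ψ01 X
  /-- ψ₀ lands in 𝔨₀ -/
  comm : ∀ X : h0, ψ00 X ∘ₗ d = d ∘ₗ ψ01 X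
  /-- compatibility with dt and δ -/
  compat0 : ∀ A : h1, ψ00 (dt A) = d ∘ₗ ψ1 A
  compat1 : ∀ A : h1, ψ01 (dt A) = ψ1 A ∘ₗ d
  /-- compatibility with the actions -/
  equivar : ∀ (X : h0) (A : h1), ψ1 (φ X A) = ψ01 X ∘ₗ ψ1 A - ψ1 A ∘ₗ ψ00 X

variable {k V0 V1 : Type*} [Field k] [AddCommGroup V0] [Module k V0]
  [AddCommGroup V1] [Module k V1] {h1 h0 : Type*}
  [LieRing h1] [LieAlgebra k h1] [LieRing h0] [LieAlgebra k h0]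
  {d : V1 →ₗ[k] V0} {dt : h1 →ₗ[k] h0} {φ : h0 →ₗ[k] h1 →ₗ[k] h1}

/-- The bracket on 𝔥₀ ⊕ V₀. -/
def br0 (S : LieStrictToEnd k V0 V1 h1 h0 d dt φ) (p q : h0 × V0) : h0 × V0 :=
  (⁅p.1, q.1⁆, S.ψ00 p.1 q.2 - S.ψ00 q.1 p.2)

/-- The bracket on 𝔥₁ ⊕ V₁. -/
def br1 (S : LieStrictToEnd k V0 V1 h1 h0 d dt φ) (p q : h1 × V1) : h1 × V1 :=
  (⁅p.1, q.1⁆, S.ψ01 (dt p.1) q.2 - S.ψ01 (dt q.1) p.2)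

/-- The map dt×d : 𝔥₁ ⊕ V₁ → 𝔥₀ ⊕ V₀. -/
def dtTimesd (d : V1 →ₗ[k] V0) (dt : h1 →ₗ[k] h0) (p : h1 × V1) : h0 × V0 :=
  (dt p.1, d p.2)

/-- The action φ̃ of 𝔥₀ ⊕ V₀ on 𝔥₁ ⊕ V₁. -/
def tphiL (S : LieStrictToEnd k V0 V1 h1 h0 d dt φ) (p : h0 × V0) (q : h1 × V1) :
    h1 × V1 :=
  (φ p.1 q.1, S.ψ01 p.1 q.2 - S.ψ1 q.1 p.2)

theorem stmt_14 (d : V1 →ₗ[k] V0) (dt : h1 →ₗ[k] h0) (φ : h0 →ₗ[k] h1 →ₗ[k] h1)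
    (S : LieStrictToEnd k V0 V1 h1 h0 d dt φ) :
    -- (i) each φ̃_{(X,ξ)} is a derivation of the bracket of 𝔥₁ ⊕ V₁
    (∀ (p : h0 × V0) (q r : h1 × V1),
      tphiL S p (br1 S q r) = br1 S (tphiL S p q) r + br1 S q (tphiL S p r)) ∧
    -- (i) φ̃ is a Lie algebra action
    (∀ (p p' : h0 × V0) (q : h1 × V1),
      tphiL S (br0 S p p') q = tphiL S p (tphiL S p' q) - tphiL S p' (tphiL S p q)) ∧
    -- (ii) (dt×d)(φ̃_{(X,ξ)}(A,m)) = [(X,ξ),(dt(A),d(m))]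
    (∀ (p : h0 × V0) (q : h1 × V1),
      dtTimesd d dt (tphiL S p q) = br0 S p (dtTimesd d dt q)) ∧
    -- (iii) the Pfeiffer identity φ̃_{(dt(A),d(m))}(B,n) = [(A,m),(B,n)]
    (∀ q r : h1 × V1, tphiL S (dtTimesd d dt q) r = br1 S q r) := by
  have comm : ∀ X v, S.ψ00 X (d v) = d (S.ψ01 X v) := fun X v =>
    LinearMap.congr_fun (S.comm X) v
  have c0 : ∀ A v, S.ψ00 (dt A) v = d (S.ψ1 A v) := fun A v =>
    LinearMap.congr_fun (S.compat0 A) v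
  have c1 : ∀ A v, S.ψ01 (dt A) v = S.ψ1 A (d v) := fun A v =>
    LinearMap.congr_fun (S.compat1 A) v
  have eq : ∀ X A v, S.ψ1 (φ X A) v = S.ψ01 X (S.ψ1 A v) - S.ψ1 A (S.ψ00 X v) := fun X A v =>
    LinearMap.congr_fun (S.equivar X A) v
  have b1 : ∀ A B v, S.ψ1 ⁅A, B⁆ v = S.ψ1 A (d (S.ψ1 B v)) - S.ψ1 B (d (S.ψ1 A v)) :=
    fun A B v => LinearMap.congr_fun (S.ψ1_bracket A B) v
  have b01 : ∀ X Y v, S.ψ01 ⁅X, Y⁆ v = S.ψ01 X (S.ψ01 Y v) - S.ψ01 Y (S.ψ01 X v) :=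
    fun X Y v => LinearMap.congr_fun (S.ψ01_bracket X Y) v
  refine ⟨?_, ?_, ?_, ?_⟩
  · rintro ⟨X, x⟩ ⟨A, m⟩ ⟨B, n⟩
    refine Prod.ext (S.φ_der X A B) ?_
    simp only [tphiL, br1, Prod.snd_add, c1, eq, b1, comm, map_sub]
    abel
  · rintro ⟨X, x⟩ ⟨Y, y⟩ ⟨A, m⟩
    refine Prod.ext (S.φ_hom X Y A) ?_
    simp only [tphiL, br0, Prod.snd_sub, eq, b01, map_sub]
    abel
  · rintro ⟨X, x⟩ ⟨A, m⟩
    refine Prod.ext (S.cm1 X A) ?_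
    simp only [tphiL, br0, dtTimesd, c0, comm, map_sub]
  · rintro ⟨A, m⟩ ⟨B, n⟩
    refine Prod.ext (S.cm2 A B) ?_
    simp only [tphiL, br1, dtTimesd, c1]
end

section
/- Let (𝕍,μ,ν) be a 2-term representation up to homotopy of a Lie algebra 𝔤, and define the bracket on 𝔤 ⊕ V₀ by ⟦(X,ξ),(Y,η)⟧ := ([X,Y], μ₀(X)(η) − μ₀(Y)(ξ)). Then the Jacobiator of ⟦·,·⟧ is exact: for all (X,ξ), (Y,η), (Z,γ) ∈ 𝔤 ⊕ V₀, ⟦⟦(X,ξ),(Y,η)⟧,(Z,γ)⟧ + ⟦⟦(Y,η),(Z,γ)⟧,(X,ξ)⟧ + ⟦⟦(Z,γ),(X,ξ)⟧,(Y,η)⟧ = (0, d(ν(X,Y)(γ) + ν(Y,Z)(ξ) + ν(Z,X)(η))). -/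
/- Context: k a field, V₀, V₁ vector spaces over k, d : V₁ → V₀ linear.
   A 2-term representation up to homotopy (𝕍,μ,ν) of a Lie algebra 𝔤 consists
   of μ₀ : 𝔤 → End(V₀), μ₁ : 𝔤 → End(V₁) linear and ν : 𝔤 × 𝔤 → Hom(V₀,V₁)
   alternating bilinear with d∘μ₁(X) = μ₀(X)∘d,
   μ₀([X₁,X₂]) − [μ₀(X₁),μ₀(X₂)] = d∘ν(X₁,X₂),
   μ₁([X₁,X₂]) − [μ₁(X₁),μ₁(X₂)] = ν(X₁,X₂)∘d, and
   (μ₁(X₁)∘ν(X₂,X₃) − ν(X₂,X₃)∘μ₀(X₁)) + c.p. = ν([X₁,X₂],X₃) + c.p.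
   STATEMENT 15: for ⟦(X,ξ),(Y,η)⟧ := ([X,Y], μ₀(X)(η) − μ₀(Y)(ξ)) on 𝔤 ⊕ V₀,
   the Jacobiator is exact:
   ⟦⟦(X,ξ),(Y,η)⟧,(Z,γ)⟧ + c.p. = (0, d(ν(X,Y)(γ) + ν(Y,Z)(ξ) + ν(Z,X)(η))). -/

/-- A 2-term representation up to homotopy of the Lie algebra `g` on the
complex `d : V1 → V0`. -/
structure RepUpToHomotopy (k : Type*) [Field k] (V0 V1 : Type*)
    [AddCommGroup V0] [Module k V0] [AddCommGroup V1] [Module k V1]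
    (g : Type*) [LieRing g] [LieAlgebra k g] (d : V1 →ₗ[k] V0) where
  μ0 : g →ₗ[k] Module.End k V0
  μ1 : g →ₗ[k] Module.End k V1
  ν : g →ₗ[k] g →ₗ[k] (V0 →ₗ[k] V1)
  ν_alt : ∀ X : g, ν X X = 0
  compat : ∀ X : g, d ∘ₗ μ1 X = μ0 X ∘ₗ d
  hμ0 : ∀ X Y : g,
    μ0 ⁅X, Y⁆ - (μ0 X * μ0 Y - μ0 Y * μ0 X) = d ∘ₗ ν X Y
  hμ1 : ∀ X Y : g,
    μ1 ⁅X, Y⁆ - (μ1 X * μ1 Y - μ1 Y * μ1 X) = ν X Y ∘ₗ d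
  hν : ∀ X1 X2 X3 : g,
    (μ1 X1 ∘ₗ ν X2 X3 - ν X2 X3 ∘ₗ μ0 X1)
      + (μ1 X2 ∘ₗ ν X3 X1 - ν X3 X1 ∘ₗ μ0 X2)
      + (μ1 X3 ∘ₗ ν X1 X2 - ν X1 X2 ∘ₗ μ0 X3)
    = ν ⁅X1, X2⁆ X3 + ν ⁅X2, X3⁆ X1 + ν ⁅X3, X1⁆ X2

variable {k V0 V1 g : Type*} [Field k] [AddCommGroup V0] [Module k V0]
  [AddCommGroup V1] [Module k V1] [LieRing g] [LieAlgebra k g]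
  {d : V1 →ₗ[k] V0}

/-- The bracket ⟦(X,ξ),(Y,η)⟧ := ([X,Y], μ₀(X)(η) − μ₀(Y)(ξ)) on 𝔤 ⊕ V₀. -/
def brG (R : RepUpToHomotopy k V0 V1 g d) (p q : g × V0) : g × V0 :=
  (⁅p.1, q.1⁆, R.μ0 p.1 q.2 - R.μ0 q.1 p.2)

theorem stmt_15 (d : V1 →ₗ[k] V0) (R : RepUpToHomotopy k V0 V1 g d) :
    ∀ p q r : g × V0,
      brG R (brG R p q) r + brG R (brG R q r) p + brG R (brG R r p) q
        = (0, d (R.ν p.1 q.1 r.2 + R.ν q.1 r.1 p.2 + R.ν r.1 p.1 q.2)) := by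
  rintro ⟨X, ξ⟩ ⟨Y, η⟩ ⟨Z, γ⟩
  have h : ∀ (A B : g) (v : V0),
      d (R.ν A B v) = R.μ0 ⁅A, B⁆ v - (R.μ0 A (R.μ0 B v) - R.μ0 B (R.μ0 A v)) := by
    intro A B v
    have := congrArg (fun f => f v) (R.hμ0 A B)
    simpa using this.symm
  refine Prod.ext ?_ ?_
  · have hj := lie_jacobi X Y Z
    simp only [brG, Prod.fst_add]
    rw [← lie_skew Z ⁅X, Y⁆, ← lie_skew X ⁅Y, Z⁆, ← lie_skew Y ⁅Z, X⁆] at hj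
    rw [← neg_eq_zero, ← hj]
    abel
  · simp only [brG, Prod.snd_add, map_add, map_sub, h]
    abel
end

section
/- Let (𝕍,μ,ν) be a 2-term representation up to homotopy of a Lie algebra 𝔤. Then the bracket on 𝔤 ⊕ Hom(V₀,V₁) defined by [(X,A),(Y,B)] := ([X,Y], (μ₁(X)∘B − B∘μ₀(X)) − (μ₁(Y)∘A − A∘μ₀(Y)) + (A∘d∘B − B∘d∘A) − ν(X,Y)) is bilinear, alternating, and satisfies the Jacobi identity, so 𝔤 ⊕ Hom(V₀,V₁) is a Lie algebra (the total Lie algebra of the butterfly associated to the nonstrict morphism (μ,ν) : 𝔤 → End(𝕍)). -/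
variable {k V0 V1 g : Type*} [Field k] [AddCommGroup V0] [Module k V0]
  [AddCommGroup V1] [Module k V1] [LieRing g] [LieAlgebra k g]
  {d : V1 →ₗ[k] V0}

/-- The bracket on 𝔤 ⊕ Hom(V₀,V₁). -/
def brE (R : RepUpToHomotopy k V0 V1 g d) (p q : g × (V0 →ₗ[k] V1)) :
    g × (V0 →ₗ[k] V1) :=
  (⁅p.1, q.1⁆,
    (R.μ1 p.1 ∘ₗ q.2 - q.2 ∘ₗ R.μ0 p.1) - (R.μ1 q.1 ∘ₗ p.2 - p.2 ∘ₗ R.μ0 q.1)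
      + (p.2 ∘ₗ d ∘ₗ q.2 - q.2 ∘ₗ d ∘ₗ p.2) - R.ν p.1 q.1)

theorem stmt_16 (d : V1 →ₗ[k] V0) (R : RepUpToHomotopy k V0 V1 g d) :
    (∀ p q r : g × (V0 →ₗ[k] V1), brE R (p + q) r = brE R p r + brE R q r) ∧
    (∀ (c : k) (p q : g × (V0 →ₗ[k] V1)), brE R (c • p) q = c • brE R p q) ∧
    (∀ p q r : g × (V0 →ₗ[k] V1), brE R p (q + r) = brE R p q + brE R p r) ∧
    (∀ (c : k) (p q : g × (V0 →ₗ[k] V1)), brE R p (c • q) = c • brE R p q) ∧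
    (∀ p : g × (V0 →ₗ[k] V1), brE R p p = 0) ∧
    (∀ p q r : g × (V0 →ₗ[k] V1),
      brE R (brE R p q) r + brE R (brE R q r) p + brE R (brE R r p) q = 0) := by
  have m1 : ∀ X Y w, R.μ1 ⁅X, Y⁆ w = R.ν X Y (d w) + (R.μ1 X (R.μ1 Y w) - R.μ1 Y (R.μ1 X w)) := by
    intro X Y w
    have h := LinearMap.congr_fun (R.hμ1 X Y) w
    simp only [LinearMap.sub_apply, Module.End.mul_apply, LinearMap.comp_apply] at h
    exact sub_eq_iff_eq_add.mp h
  have m0 : ∀ X Y w, R.μ0 ⁅X, Y⁆ w = d (R.ν X Y w) + (R.μ0 X (R.μ0 Y w) - R.μ0 Y (R.μ0 X w)) := by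
    intro X Y w
    have h := LinearMap.congr_fun (R.hμ0 X Y) w
    simp only [LinearMap.sub_apply, Module.End.mul_apply, LinearMap.comp_apply] at h
    exact sub_eq_iff_eq_add.mp h
  have cd : ∀ X w, d (R.μ1 X w) = R.μ0 X (d w) := fun X w => LinearMap.congr_fun (R.compat X) w
  refine ⟨?_, ?_, ?_, ?_, ?_, ?_⟩
  · rintro ⟨X, A⟩ ⟨Y, B⟩ ⟨Z, C⟩
    refine Prod.ext (by simp [brE]) ?_
    ext v
    simp [brE]
    abel
  · rintro c ⟨X, A⟩ ⟨Y, B⟩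
    refine Prod.ext (by simp [brE]) ?_
    ext v
    simp [brE, smul_sub, smul_add]
  · rintro ⟨X, A⟩ ⟨Y, B⟩ ⟨Z, C⟩
    refine Prod.ext (by simp [brE]) ?_
    ext v
    simp [brE]
    abel
  · rintro c ⟨X, A⟩ ⟨Y, B⟩
    refine Prod.ext (by simp [brE]) ?_
    ext v
    simp [brE, smul_sub, smul_add]
  · rintro ⟨X, A⟩
    refine Prod.ext (by simp [brE]) ?_
    simp [brE, R.ν_alt]
  · rintro ⟨X, A⟩ ⟨Y, B⟩ ⟨Z, C⟩
    refine Prod.ext ?_ ?_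
    · have h := lie_jacobi X Y Z
      rw [← lie_skew X ⁅Y, Z⁆, ← lie_skew Y ⁅Z, X⁆, ← lie_skew Z ⁅X, Y⁆] at h
      simp only [brE, Prod.fst_add, Prod.fst_zero]
      rw [← neg_eq_zero, ← h]
      abel
    · ext v
      have h := LinearMap.congr_fun (R.hν X Y Z) v
      rw [← sub_eq_zero] at h
      simp only [LinearMap.sub_apply, LinearMap.add_apply, LinearMap.comp_apply] at h
      simp only [brE, Prod.snd_add, Prod.snd_zero, LinearMap.sub_apply, LinearMap.add_apply,
        LinearMap.comp_apply, LinearMap.zero_apply, map_add, map_sub, m1, m0, cd]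
      rw [← h]
      abel
end

section
/- Let V be a vector space over a field of characteristic zero (e.g. ℝ) and define the omni-Lie bracket on 𝔤𝔩(V) ⊕ V by ⟦(A,u),(B,v)⟧ := ([A,B], ½(A(v) − B(u))), where [A,B] = A∘B − B∘A. Then the Jacobiator of this bracket is given by ⟦⟦(A,u),(B,v)⟧,(C,w)⟧ + ⟦⟦(B,v),(C,w)⟧,(A,u)⟧ + ⟦⟦(C,w),(A,u)⟧,(B,v)⟧ = (0, ¼([A,B](w) + [B,C](u) + [C,A](v))). -/
/- Context: V a vector space over a field k of characteristic zero,
   𝔤𝔩(V) = End(V) with commutator [A,B] = A∘B − B∘A.  The omni-Lie algebra is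
   𝔤𝔩(V) ⊕ V with ⟦(A,u),(B,v)⟧ := ([A,B], ½(A(v) − B(u))).
   STATEMENT 18: the Jacobiator of this bracket satisfies
   ⟦⟦(A,u),(B,v)⟧,(C,w)⟧ + c.p. = (0, ¼([A,B](w) + [B,C](u) + [C,A](v))). -/

variable {k V : Type*} [Field k] [CharZero k] [AddCommGroup V] [Module k V]

/-- The omni-Lie bracket on 𝔤𝔩(V) ⊕ V. -/
def omniBr (p q : Module.End k V × V) : Module.End k V × V :=
  (p.1 * q.1 - q.1 * p.1, (2⁻¹ : k) • (p.1 q.2 - q.1 p.2))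

theorem stmt_18 :
    ∀ p q r : Module.End k V × V,
      omniBr (omniBr p q) r + omniBr (omniBr q r) p + omniBr (omniBr r p) q
        = (0, (4⁻¹ : k) • ((p.1 * q.1 - q.1 * p.1) r.2 + (q.1 * r.1 - r.1 * q.1) p.2
            + (r.1 * p.1 - p.1 * r.1) q.2)) := by
  rintro ⟨A, u⟩ ⟨B, v⟩ ⟨C, w⟩
  refine Prod.ext ?_ ?_
  · simp only [omniBr, Prod.fst_add]
    noncomm_ring
  · simp only [omniBr, Prod.snd_add, LinearMap.sub_apply, Module.End.mul_apply, map_smul, map_sub]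
    module
end
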